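/- Let q > 2 be a prime power and let a ∈ 𝔽_q be nonzero. Then, as permutations of 𝔽_q, the transposition (0,a) satisfies: (0,a) = λ ∘ ρ ∘ σ_a ∘ ρ ∘ τ' ∘ ρ, where ρ is the permutation a ↦ a^{q−2}, σ_a is x ↦ x + a, τ' is x ↦ x − a⁻¹, and λ is x ↦ −a²x + a. -/

import Mathlib

/-- In a finite field with more than two elements, inversion is the power map `x ↦ x ^ (q - 2)`. -/
theorem FiniteField.pow_card_sub_two_eq_inv {F : Type*} [Field F] [Fintype F]
    (hq : 2 < Fintype.card F) (x : F) : x ^ (Fintype.card F - 2) = x⁻¹ := by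
  by_cases hx : x = 0
  · subst hx
    rw [inv_zero, zero_pow (by omega)]
  · refine eq_inv_of_mul_eq_one_left ?_
    rw [← pow_succ, show Fintype.card F - 2 + 1 = Fintype.card F - 1 by omega]
    exact FiniteField.pow_card_sub_one_eq_one x hx

/-- for nonzero a ∈ 𝔽_q, as permutations of 𝔽_q,
(0,a) = λ ∘ ρ ∘ σ_a ∘ ρ ∘ τ' ∘ ρ, where ρ : x ↦ x^{q−2}, σ_a : x ↦ x + a,
τ' : x ↦ x − a⁻¹, and λ : x ↦ −a²x + a. -/
theorem swap_identity_recovering_zieve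
    {F : Type*} [Field F] [Fintype F] [DecidableEq F]
    (hq : 2 < Fintype.card F)
    (a : F) (ha : a ≠ 0)
    (ρ : Equiv.Perm F) (hρ : ∀ x : F, ρ x = x ^ (Fintype.card F - 2))
    (lam : Equiv.Perm F) (hlam : ∀ x : F, lam x = -a ^ 2 * x + a) :
    Equiv.swap (0 : F) a
      = lam * ρ * Equiv.addRight a * ρ * Equiv.subRight a⁻¹ * ρ := by
  have hinv (x : F) : ρ x = x⁻¹ := by
    rw [hρ, FiniteField.pow_card_sub_two_eq_inv hq]
  ext x
  simp only [Equiv.Perm.mul_apply, hinv, hlam, Equiv.coe_addRight, Equiv.subRight_apply]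
  by_cases hx : x = 0
  · subst hx
    simp
  by_cases hxa : x = a
  · subst hxa
    simp only [Equiv.swap_apply_right, sub_self, inv_zero, zero_add]
    field_simp
    ring
  rw [Equiv.swap_apply_of_ne_of_ne hx hxa]
  have hsub : a - x ≠ 0 := sub_ne_zero.mpr (Ne.symm hxa)
  have h₁ : x⁻¹ - a⁻¹ = (a - x) / (a * x) := by
    field_simp
  have h₂ : a * x / (a - x) + a = a ^ 2 / (a - x) := by
    field_simp
    ring
  rw [h₁, inv_div, h₂, inv_div]
  field_simp
  ring
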